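/- Let {t_i}_{i∈ℕ} be a sequence of positive integers with t_i → ∞, and let f_i: C(b_1,…,b_{n-1},−t_i) ⇝ C be a sequence of short local maps from standard complexes to a fixed knot-like complex C. Then there exists some b_n > 0 and a short local map f: C(b_1,…,b_{n-1},b_n) ⇝ C. -/

import Mathlib

/-!
Common setup: the ring `R = 𝔽₂[U,V]/(UV = 0)`, bigraded free finitely generated chain
complexes over `R` ("pre-complexes"), knot-like complexes, local maps and local
equivalence, standard and semistandard complexes, short maps, the `Z^!` order,
the invariants `a_i`, `φ_j`, `P`, shift maps, tensor products, duals, and direct sums.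
-/

set_option synthInstance.maxHeartbeats 1000000
set_option maxHeartbeats 1000000

noncomputable section

/-- The polynomial ring `𝔽₂[U,V]`. -/
abbrev PolyUV : Type := MvPolynomial (Fin 2) (ZMod 2)

/-- The ideal `(U·V)`. -/
def IUV : Ideal PolyUV := Ideal.span {(MvPolynomial.X 0 * MvPolynomial.X 1 : PolyUV)}

/-- The ring `R = 𝔽₂[U,V]/(UV = 0)`. -/
abbrev RUV : Type := PolyUV ⧸ IUV

instance : CommRing RUV := Ideal.Quotient.commRing IUV

/-- The image of `U` in `R`. -/
def Uv : RUV := Ideal.Quotient.mk IUV (MvPolynomial.X 0)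

/-- The image of `V` in `R`. -/
def Vv : RUV := Ideal.Quotient.mk IUV (MvPolynomial.X 1)

/-- `r ∈ R` is homogeneous of bidegree `(p, q)` for the bigrading with
`gr(U) = (-2, 0)`, `gr(V) = (0, -2)`, `gr(1) = (0, 0)` (coefficients in `𝔽₂`). -/
def IsHomog (r : RUV) (p q : ℤ) : Prop :=
  r = 0 ∨ (∃ a : ℕ, r = Uv ^ a ∧ p = -(2 * (a : ℤ)) ∧ q = 0) ∨
    (∃ b : ℕ, r = Vv ^ b ∧ p = 0 ∧ q = -(2 * (b : ℤ)))

/-- A finitely generated free bigraded module over `R` with a distinguished basis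
indexed by `Fin n`, together with a bigrading `gr` on the basis and a matrix `dm`
recording a prospective differential: `dm i j` is the coefficient of the `j`-th basis
vector in the differential of the `i`-th basis vector. -/
structure PreCx where
  n : ℕ
  gr : Fin n → ℤ × ℤ
  dm : Fin n → Fin n → RUV

/-- The underlying free `R`-module of a pre-complex. -/
abbrev Msub (C : PreCx) : Type := Fin C.n →₀ RUV

/-- The differential of a pre-complex, as an `R`-linear map. -/
def dmap (C : PreCx) : Msub C →ₗ[RUV] Msub C :=
  Finsupp.linearCombination RUV fun i => ∑ j, Finsupp.single j (C.dm i j)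

/-- The submodule `U·C ⊆ C`; `C/U` is the quotient by this submodule. -/
def uSub (C : PreCx) : Submodule RUV (Msub C) :=
  LinearMap.range (LinearMap.lsmul RUV (Msub C) Uv)

/-- The submodule `V·C ⊆ C`; `C/V` is the quotient by this submodule. -/
def vSub (C : PreCx) : Submodule RUV (Msub C) :=
  LinearMap.range (LinearMap.lsmul RUV (Msub C) Vv)

/-- Chains which die in the homology of `C/U`: the preimage in `C` of the boundaries of
the induced differential on `C/U`. -/
def bdryU (C : PreCx) : Submodule RUV (Msub C) := uSub C ⊔ LinearMap.range (dmap C)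

/-- Chains which die in the homology of `C/V`. -/
def bdryV (C : PreCx) : Submodule RUV (Msub C) := vSub C ⊔ LinearMap.range (dmap C)

/-- A chain `x ∈ C` is homogeneous of bidegree `(p, q)`. -/
def ChainHomog (C : PreCx) (x : Msub C) (p q : ℤ) : Prop :=
  ∀ j, IsHomog (x j) (p - (C.gr j).1) (q - (C.gr j).2)

/-- `x` is a `V`-tower class generator: its class in `H_*(C/U)` is a `V`-nontorsion cycle
whose image generates `H_*(C/U)/(V-torsion)` (equivalently, it is maximally `V`-graded
among `V`-nontorsion classes). -/
def IsVTowerGen (C : PreCx) (x : Msub C) : Prop :=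
  dmap C x ∈ uSub C ∧ (∀ k : ℕ, Vv ^ k • x ∉ bdryU C) ∧
    ∀ z : Msub C, dmap C z ∈ uSub C →
      ∃ (r : RUV) (k : ℕ), Vv ^ k • (z - r • x) ∈ bdryU C

/-- `x` is a `U`-tower class generator: its class in `H_*(C/V)` is a `U`-nontorsion cycle
whose image generates `H_*(C/V)/(U-torsion)`. -/
def IsUTowerGen (C : PreCx) (x : Msub C) : Prop :=
  dmap C x ∈ vSub C ∧ (∀ k : ℕ, Uv ^ k • x ∉ bdryV C) ∧
    ∀ z : Msub C, dmap C z ∈ vSub C →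
      ∃ (r : RUV) (k : ℕ), Uv ^ k • (z - r • x) ∈ bdryV C

/-- `C` is a chain complex over `R` whose differential has degree `(-1, -1)`. -/
def IsCplx (C : PreCx) : Prop :=
  (∀ x, dmap C (dmap C x) = 0) ∧
    ∀ i j, IsHomog (C.dm i j) ((C.gr i).1 - 1 - (C.gr j).1) ((C.gr i).2 - 1 - (C.gr j).2)

/-- A knot-like complex: a free, finitely generated, bigraded chain complex over `R`
whose differential has degree `(-1,-1)`, such that `H_*(C/U)/(V`-torsion`) ≅ 𝔽₂[V]` with
all `V`-nontorsion elements of `H_*(C/U)` in `U`-grading `0`, and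
`H_*(C/V)/(U`-torsion`) ≅ 𝔽₂[U]` with all `U`-nontorsion elements of `H_*(C/V)` in
`V`-grading `0`. -/
structure IsKnotLike (C : PreCx) : Prop where
  dsq : ∀ x, dmap C (dmap C x) = 0
  dhomog : ∀ i j, IsHomog (C.dm i j)
    ((C.gr i).1 - 1 - (C.gr j).1) ((C.gr i).2 - 1 - (C.gr j).2)
  vTowerExists : ∃ x, IsVTowerGen C x
  vTowerGr : ∀ x p q, ChainHomog C x p q → dmap C x ∈ uSub C →
    (∀ k : ℕ, Vv ^ k • x ∉ bdryU C) → p = 0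
  uTowerExists : ∃ x, IsUTowerGen C x
  uTowerGr : ∀ x p q, ChainHomog C x p q → dmap C x ∈ vSub C →
    (∀ k : ℕ, Uv ^ k • x ∉ bdryV C) → q = 0

/-- A module map `f : C₁ → C₂` is homogeneous of bidegree `(s, t)`. -/
def MapHomogShift (C₁ C₂ : PreCx) (f : Msub C₁ →ₗ[RUV] Msub C₂) (s t : ℤ) : Prop :=
  ∀ i j, IsHomog (f (Finsupp.single i 1) j)
    ((C₁.gr i).1 + s - (C₂.gr j).1) ((C₁.gr i).2 + t - (C₂.gr j).2)

/-- A local map `f : C₁ → C₂`: an absolutely `U`-graded, relatively `V`-graded,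
`R`-equivariant chain map inducing an isomorphism on `H_*(·/U)/(V-torsion)`
(equivalently, taking `V`-tower generators to `V`-tower generators). -/
structure IsLocalMap (C₁ C₂ : PreCx) (f : Msub C₁ →ₗ[RUV] Msub C₂) : Prop where
  chain : ∀ x, f (dmap C₁ x) = dmap C₂ (f x)
  graded : ∃ s : ℤ, MapHomogShift C₁ C₂ f 0 s
  towers : ∀ x, IsVTowerGen C₁ x → IsVTowerGen C₂ (f x)

/-- `C₁ ≤ C₂`: there exists a local map `C₁ → C₂`. -/
def LocalLE (C₁ C₂ : PreCx) : Prop := ∃ f, IsLocalMap C₁ C₂ f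

/-- Local equivalence of complexes: local maps in both directions. -/
def LocalEquiv (C₁ C₂ : PreCx) : Prop := LocalLE C₁ C₂ ∧ LocalLE C₂ C₁

/-- `C` is reduced: `∂ ≡ 0 mod (U, V)`. -/
def Reduced (C : PreCx) : Prop := ∀ i j, C.dm i j ∈ Ideal.span ({Uv, Vv} : Set RUV)

/-! ### Standard complexes -/

/-- The shift in bigrading from `x_k` to `x_{k+1}` in a standard complex, where the
parameter joining them is `b` (`k` is the 0-based index of the parameter, so the
parameter is a `U`-power arrow if `k` is even and a `V`-power arrow if `k` is odd). -/
def stepShift (k : ℕ) (b : ℤ) : ℤ × ℤ :=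
  if k % 2 = 0 then
    if b < 0 then (2 * (b.natAbs : ℤ) - 1, -1) else (1 - 2 * (b.natAbs : ℤ), 1)
  else
    if b < 0 then (-1, 2 * (b.natAbs : ℤ) - 1) else (1, 1 - 2 * (b.natAbs : ℤ))

/-- Bigrading of `x_i` relative to `x_0` in the standard complex with parameters `L`. -/
def grRel (L : List ℤ) (i : ℕ) : ℤ × ℤ :=
  ∑ k ∈ Finset.range i, stepShift k (L.getD k 0)

/-- The bigrading of the standard complex of parameters `L`, normalized so that
`gr_U(x_0) = 0` and `gr_V(x_n) = 0`. -/
def stdGr (L : List ℤ) (i : Fin (L.length + 1)) : ℤ × ℤ :=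
  ((grRel L (i : ℕ)).1, (grRel L (i : ℕ)).2 - (grRel L L.length).2)

/-- The differential matrix of the standard complex of parameters `L = (b_1, …, b_n)`:
for `i` odd (1-based), `∂_U x_{i-1} = U^{|b_i|} x_i` if `b_i < 0` and
`∂_U x_i = U^{b_i} x_{i-1}` if `b_i > 0`; for `i` even the same with `V` in place of `U`;
all other differentials vanish. -/
def stdDm (L : List ℤ) (i j : Fin (L.length + 1)) : RUV :=
  if (j : ℕ) = (i : ℕ) + 1 ∧ L.getD (i : ℕ) 0 < 0 then
    (if (i : ℕ) % 2 = 0 then Uv else Vv) ^ (L.getD (i : ℕ) 0).natAbs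
  else if (i : ℕ) = (j : ℕ) + 1 ∧ 0 < L.getD (j : ℕ) 0 then
    (if (j : ℕ) % 2 = 0 then Uv else Vv) ^ (L.getD (j : ℕ) 0).natAbs
  else 0

/-- The standard complex `C(b_1, …, b_n)` of a list of parameters `L = (b_1, …, b_n)`,
with generators `x_0, …, x_n`.  (For `L = []` this is the trivial complex `R`.) -/
def StdCx (L : List ℤ) : PreCx := ⟨L.length + 1, stdGr L, stdDm L⟩

/-- `L` is a valid parameter sequence for a standard complex: all entries are nonzero
and the length is even (possibly zero). -/
def IsStdSeq (L : List ℤ) : Prop := (∀ b ∈ L, b ≠ 0) ∧ Even L.length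

/-- The trivial standard complex `C(0) = R`. -/
def trivCx : PreCx := StdCx []

/-- The bigrading of the semistandard complex `C'(b_1, …, b_n)` (`n` odd), inherited from
the ambient standard complex `C(b_1, …, b_n, 1)`. -/
def semiGr (L : List ℤ) (i : Fin (L.length + 1)) : ℤ × ℤ :=
  ((grRel L (i : ℕ)).1, (grRel L (i : ℕ)).2 - (grRel L L.length).2 + 1)

/-- The semistandard complex `C'(b_1, …, b_n)` (`n` odd): the subcomplex of
`C(b_1, …, b_n, 1)` generated by `x_0, …, x_n`. -/
def SemiStdCx (L : List ℤ) : PreCx := ⟨L.length + 1, semiGr L, stdDm L⟩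

/-! ### Tensor products, duals, direct sums -/

/-- The tensor product (over `R`) of two pre-complexes, with basis `x_i ⊗ y_j` and
differential `∂(x ⊗ y) = ∂x ⊗ y + x ⊗ ∂y` (signs are irrelevant in characteristic 2). -/
def tensorCx (C₁ C₂ : PreCx) : PreCx where
  n := C₁.n * C₂.n
  gr := fun p => C₁.gr (finProdFinEquiv.symm p).1 + C₂.gr (finProdFinEquiv.symm p).2
  dm := fun p q =>
    (if (finProdFinEquiv.symm p).2 = (finProdFinEquiv.symm q).2 then
      C₁.dm (finProdFinEquiv.symm p).1 (finProdFinEquiv.symm q).1 else 0) +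
    (if (finProdFinEquiv.symm p).1 = (finProdFinEquiv.symm q).1 then
      C₂.dm (finProdFinEquiv.symm p).2 (finProdFinEquiv.symm q).2 else 0)

/-- The dual complex `C^∨ = Hom_R(C, R)`, described on the dual basis: the gradings are
negated and the differential matrix is transposed. -/
def dualCx (C : PreCx) : PreCx := ⟨C.n, fun i => -C.gr i, fun i j => C.dm j i⟩

/-- The direct sum of two pre-complexes. -/
def sumCx (C₁ C₂ : PreCx) : PreCx where
  n := C₁.n + C₂.n
  gr := fun p => Sum.elim C₁.gr C₂.gr (finSumFinEquiv.symm p)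
  dm := fun p q =>
    match finSumFinEquiv.symm p, finSumFinEquiv.symm q with
    | Sum.inl i, Sum.inl k => C₁.dm i k
    | Sum.inr j, Sum.inr l => C₂.dm j l
    | _, _ => 0

/-- A homotopy equivalence of bigraded chain complexes over `R`: chain maps `f, g`
preserving the bigrading, with `g ∘ f ≃ id` and `f ∘ g ≃ id` via `R`-equivariant
homotopies of bidegree `(1, 1)`. -/
def HomotopyEquivCx (C₁ C₂ : PreCx) : Prop :=
  ∃ (f : Msub C₁ →ₗ[RUV] Msub C₂) (g : Msub C₂ →ₗ[RUV] Msub C₁)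
    (H : Msub C₁ →ₗ[RUV] Msub C₁) (K : Msub C₂ →ₗ[RUV] Msub C₂),
    (∀ x, f (dmap C₁ x) = dmap C₂ (f x)) ∧
    (∀ y, g (dmap C₂ y) = dmap C₁ (g y)) ∧
    MapHomogShift C₁ C₂ f 0 0 ∧ MapHomogShift C₂ C₁ g 0 0 ∧
    MapHomogShift C₁ C₁ H 1 1 ∧ MapHomogShift C₂ C₂ K 1 1 ∧
    (∀ x, g (f x) - x = dmap C₁ (H x) + H (dmap C₁ x)) ∧
    (∀ y, f (g y) - y = dmap C₂ (K y) + K (dmap C₂ y))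

/-- An isomorphism of bigraded chain complexes over `R`. -/
def IsBigradedChainIso (C₁ C₂ : PreCx) (f : Msub C₁ →ₗ[RUV] Msub C₂) : Prop :=
  Function.Bijective f ∧ (∀ x, f (dmap C₁ x) = dmap C₂ (f x)) ∧ MapHomogShift C₁ C₂ f 0 0

/-! ### Short maps -/

/-- A short map `f : C(b_1, …, b_n) ⇝ C`: an absolutely `U`-graded, relatively
`V`-graded `R`-module map which is a chain map at `x_1, …, x_{n-1}` and commutes with
the `V`-part of the differential at `x_n` (for reduced `C`, the failure
`∂ f(x_n) - f(∂_V x_n)` is exactly `∂_U f(x_n) ∈ U·C`). -/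
def IsShortMap (L : List ℤ) (C : PreCx) (f : Msub (StdCx L) →ₗ[RUV] Msub C) : Prop :=
  (∃ s : ℤ, MapHomogShift (StdCx L) C f 0 s) ∧
  (∀ i : Fin (L.length + 1), 1 ≤ (i : ℕ) → (i : ℕ) + 1 ≤ L.length →
    f (dmap (StdCx L) (Finsupp.single i 1)) = dmap C (f (Finsupp.single i 1))) ∧
  dmap C (f (Finsupp.single (Fin.last L.length) 1)) -
    f (dmap (StdCx L) (Finsupp.single (Fin.last L.length) 1)) ∈ uSub C

/-- A short local map: a short map sending the `V`-tower generator `x_0` to a `V`-tower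
generator (hence inducing an isomorphism on `H_*(·/U)/(V-torsion)`). -/
def IsShortLocalMap (L : List ℤ) (C : PreCx) (f : Msub (StdCx L) →ₗ[RUV] Msub C) : Prop :=
  IsShortMap L C f ∧ IsVTowerGen C (f (Finsupp.single (0 : Fin (L.length + 1)) 1))

/-- A local map from the semistandard complex `C'(b_1, …, b_n)` to a knot-like complex:
a grading-preserving `R`-equivariant chain map under which the class of `x_0`
generates `H_*(C/U)/(V-torsion)`. -/
def IsSemiLocalMap (L : List ℤ) (C : PreCx) (f : Msub (SemiStdCx L) →ₗ[RUV] Msub C) : Prop :=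
  (∀ x, f (dmap (SemiStdCx L) x) = dmap C (f x)) ∧
  MapHomogShift (SemiStdCx L) C f 0 0 ∧
  IsVTowerGen C (f (Finsupp.single (0 : Fin (L.length + 1)) 1))

/-! ### The order `Z^!` and the numerical invariants -/

/-- The embedding of `Z^!` into `ℚ` realizing the order
`-1 <^! -2 <^! ⋯ <^! 0 <^! ⋯ <^! 2 <^! 1`: send `0 ↦ 0` and `a ↦ 1/a` otherwise. -/
def qval (a : ℤ) : ℚ := if a = 0 then 0 else 1 / (a : ℚ)

/-- The order `≤^!` on `Z^!`. -/
def bangLE (a b : ℤ) : Prop := qval a ≤ qval b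

/-- Pad a finite sequence with trailing zeros. -/
def seqPad (L : List ℤ) (i : ℕ) : ℤ := L.getD i 0

/-- The lexicographic order on finite integer sequences induced by `≤^!`, padding the
shorter sequence with trailing zeros. -/
def bangLexLE (L₁ L₂ : List ℤ) : Prop :=
  (∀ i, seqPad L₁ i = seqPad L₂ i) ∨
    ∃ k, (∀ i < k, seqPad L₁ i = seqPad L₂ i) ∧ qval (seqPad L₁ k) < qval (seqPad L₂ k)

/-- `m` is an upper bound for `S ⊆ Z^!` with respect to `≤^!`. -/
def IsBangUB (S : Set ℤ) (m : ℤ) : Prop := ∀ b ∈ S, qval b ≤ qval m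

/-- `m = sup^! S`, the least upper bound of `S ⊆ Z^!` with respect to `≤^!`. -/
def IsBangLUB (S : Set ℤ) (m : ℤ) : Prop :=
  IsBangUB S m ∧ ∀ m' : ℤ, IsBangUB S m' → qval m ≤ qval m'

/-- Candidate set for the next invariant: given the already-constructed prefix `P`,
those nonzero `b` such that some standard complex `C(P, b, rest) ≤ C`. -/
def candSet (C : PreCx) (P : List ℤ) : Set ℤ :=
  {b | b ≠ 0 ∧ ∃ rest : List ℤ, IsStdSeq (P ++ b :: rest) ∧ LocalLE (StdCx (P ++ b :: rest)) C}

/-- `a` is the sequence of numerical invariants `a_i(C)` (indexed from `0`):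
once a term vanishes all later terms vanish, and otherwise each term is
`sup^!` of the corresponding candidate set. -/
def InvSeq (C : PreCx) (a : ℕ → ℤ) : Prop :=
  ∀ k : ℕ,
    ((∃ i < k, a i = 0) → a k = 0) ∧
    ((∀ i < k, a i ≠ 0) → IsBangLUB (candSet C ((List.range k).map a)) (a k))

/-- The first `n` terms of `a`, with the (all-zero) tail deleted. -/
def truncSeq (a : ℕ → ℤ) (n : ℕ) : List ℤ :=
  ((List.range n).map a).takeWhile (fun b => b != 0)

/-! ### The homomorphisms `φ_j`, `P` and the shifts `sh_m` -/

/-- `φ_j` of a standard complex `C(a_1, …, a_n)`: the signed count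
`#{i odd : a_i = j} − #{i odd : a_i = −j}` (with 1-based odd `i`). -/
def phi (j : ℕ) (L : List ℤ) : ℤ :=
  ∑ i ∈ Finset.range L.length,
    if i % 2 = 0 then
      (if L.getD i 0 = (j : ℤ) then 1 else 0) - (if L.getD i 0 = -(j : ℤ) then 1 else 0)
    else 0

/-- The shift `sh_m` on parameter sequences: entries of absolute value `≥ m` are pushed
one further from zero; entries of absolute value `< m` are fixed. -/
def shSeq (m : ℕ) (L : List ℤ) : List ℤ :=
  L.map fun a => if (m : ℤ) ≤ a then a + 1 else if a ≤ -(m : ℤ) then a - 1 else a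

/-- `P(C) = -2 ∑_{j>0} j φ_j(C) + ∑_i sgn a_i`, computed from the parameter sequence of
the standard representative (the sum over `j` is finite since `φ_j` vanishes for
`j` larger than any `|a_i|`). -/
def Pval (L : List ℤ) : ℤ :=
  -2 * (∑ j ∈ Finset.range ((L.map Int.natAbs).sum + 1), (j : ℤ) * phi j L) +
    (L.map Int.sign).sum

end

/-! ### The reduction `R → R/U ≅ 𝔽₂[V]` -/

/-- Setting `U = 0`: the ring homomorphism `R → 𝔽₂[V]`. -/
noncomputable def killU : RUV →+* Polynomial (ZMod 2) :=
  Ideal.Quotient.lift IUV (MvPolynomial.eval₂Hom Polynomial.C ![0, Polynomial.X]) (by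
    intro a ha
    obtain ⟨c, rfl⟩ := Ideal.mem_span_singleton.1 ha
    simp)

/-- The inclusion `𝔽₂[V] → R`, a section of `killU`. -/
noncomputable def polyV : Polynomial (ZMod 2) →+* RUV :=
  Polynomial.eval₂RingHom ((Ideal.Quotient.mk IUV).comp MvPolynomial.C) Vv

@[simp] lemma killU_Uv : killU Uv = 0 := by
  simp [killU, Uv]

@[simp] lemma killU_Vv : killU Vv = Polynomial.X := by
  simp [killU, Vv]

@[simp] lemma polyV_X : polyV Polynomial.X = Vv := by
  simp [polyV]

@[simp] lemma killU_polyV (P : Polynomial (ZMod 2)) : killU (polyV P) = P := by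
  have h : killU.comp polyV = RingHom.id _ := by
    apply Polynomial.ringHom_ext
    · intro a
      simp [killU, polyV]
    · simp
  exact congrArg (fun φ : Polynomial (ZMod 2) →+* Polynomial (ZMod 2) => φ P) h

lemma Uv_dvd_sub_polyV_killU (r : RUV) : Uv ∣ r - polyV (killU r) := by
  obtain ⟨p, rfl⟩ := Ideal.Quotient.mk_surjective r
  induction p using MvPolynomial.induction_on with
  | C a => simp [killU, polyV]
  | add p q hp hq =>
    have := dvd_add hp hq
    simp only [map_add]
    convert this using 1
    ring
  | mul_X p i hp =>
    fin_cases i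
    · have h : Ideal.Quotient.mk IUV (p * MvPolynomial.X 0) = Ideal.Quotient.mk IUV p * Uv := by
        simp [Uv]
      simp only [Fin.zero_eta, h, map_mul, killU_Uv, mul_zero, map_zero, sub_zero]
      exact dvd_mul_left _ _
    · have h : Ideal.Quotient.mk IUV (p * MvPolynomial.X 1) = Ideal.Quotient.mk IUV p * Vv := by
        simp [Vv]
      simp only [Fin.mk_one, h, map_mul, killU_Vv, polyV_X, ← sub_mul]
      exact hp.mul_right _

lemma killU_eq_zero_iff (r : RUV) : killU r = 0 ↔ Uv ∣ r := by
  constructor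
  · intro h
    simpa [h] using Uv_dvd_sub_polyV_killU r
  · rintro ⟨s, rfl⟩
    simp

lemma IsHomog.killU_eq {r : RUV} {p q : ℤ} (h : IsHomog r p q) :
    killU r = 0 ∨ ∃ e : ℕ, killU r = Polynomial.X ^ e ∧ p = 0 ∧ q = -(2 * (e : ℤ)) := by
  rcases h with rfl | ⟨a, rfl, hp, hq⟩ | ⟨b, rfl, hp, hq⟩
  · simp
  · rcases a with _ | a
    · exact Or.inr ⟨0, by simp, by simpa using hp, by simpa using hq⟩
    · simp
  · exact Or.inr ⟨b, by simp, hp, hq⟩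

lemma IsHomog.eq_zero_of_pos {r : RUV} {p q : ℤ} (h : IsHomog r p q) (hq : 0 < q) : r = 0 := by
  rcases h with h | ⟨a, -, -, h⟩ | ⟨b, -, -, h⟩
  · exact h
  · omega
  · omega

lemma IsHomog.Vv_pow_mul {r : RUV} {p q : ℤ} (h : IsHomog r p q) (k : ℕ) :
    killU (Vv ^ k * r) = 0 ∨
      ∃ e : ℕ, killU (Vv ^ k * r) = Polynomial.X ^ e ∧ p = 0 ∧ q - 2 * k = -(2 * (e : ℤ)) := by
  rcases h.killU_eq with h | ⟨e, h, hp, hq⟩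
  · simp [h]
  · exact Or.inr ⟨k + e, by simp [h, pow_add], hp, by push_cast; omega⟩

/-! ### Homogeneous components modulo `U` -/

/-- The component of bidegree `(p, q)` of a polynomial in `V`. -/
noncomputable def polyComp (p q : ℤ) (P : Polynomial (ZMod 2)) : Polynomial (ZMod 2) :=
  if p = 0 ∧ q ≤ 0 ∧ q % 2 = 0 then
    Polynomial.monomial (-q / 2).toNat (P.coeff (-q / 2).toNat) else 0

@[simp] lemma polyComp_zero (p q : ℤ) : polyComp p q 0 = 0 := by
  simp [polyComp]

lemma polyComp_add (p q : ℤ) (P Q : Polynomial (ZMod 2)) :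
    polyComp p q (P + Q) = polyComp p q P + polyComp p q Q := by
  unfold polyComp
  split_ifs <;> simp

lemma polyComp_sum {ι : Type*} (s : Finset ι) (p q : ℤ) (P : ι → Polynomial (ZMod 2)) :
    polyComp p q (∑ i ∈ s, P i) = ∑ i ∈ s, polyComp p q (P i) :=
  map_sum (⟨⟨polyComp p q, polyComp_zero p q⟩, polyComp_add p q⟩ :
    Polynomial (ZMod 2) →+ Polynomial (ZMod 2)) P s

lemma polyComp_eq_zero_of_pos {p q : ℤ} (hq : 0 < q) (P : Polynomial (ZMod 2)) :
    polyComp p q P = 0 :=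
  if_neg (by omega)

lemma polyComp_mul_X_pow (p q : ℤ) (P : Polynomial (ZMod 2)) (e : ℕ) :
    polyComp p q (P * Polynomial.X ^ e) = polyComp p (q + 2 * e) P * Polynomial.X ^ e := by
  unfold polyComp
  by_cases h : p = 0 ∧ q + 2 * e ≤ 0 ∧ (q + 2 * e) % 2 = 0
  · rw [if_pos h, if_pos (by omega)]
    obtain ⟨d, hd⟩ : ∃ d : ℕ, q + 2 * e = -(2 * (d : ℤ)) := ⟨(-(q + 2 * e) / 2).toNat, by omega⟩
    have h1 : (-q / 2).toNat = d + e := by omega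
    have h2 : (-(q + 2 * e) / 2).toNat = d := by omega
    rw [h1, h2, Polynomial.coeff_mul_X_pow, Polynomial.monomial_mul_X_pow]
  · rw [if_neg h, zero_mul]
    split_ifs with h'
    · rw [Polynomial.coeff_mul_X_pow', if_neg (by omega), map_zero]
    · rfl

lemma isHomog_polyV_polyComp (p q : ℤ) (P : Polynomial (ZMod 2)) :
    IsHomog (polyV (polyComp p q P)) p q := by
  unfold polyComp
  split_ifs with h
  · have h01 : ∀ c : ZMod 2, c = 0 ∨ c = 1 := by decide
    rcases h01 (P.coeff (-q / 2).toNat) with hc | hc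
    · simp [hc, IsHomog]
    · rw [hc, Polynomial.monomial_one_right_eq_X_pow, map_pow, polyV_X]
      exact Or.inr (Or.inr ⟨_, rfl, h.1, by omega⟩)
  · simp [IsHomog]

/-- A lift to `C` of the component of bidegree `(p, q)` of the class of `x` in `C/U`. -/
noncomputable def chainComp (C : PreCx) (p q : ℤ) (x : Msub C) : Msub C :=
  Finsupp.equivFunOnFinite.symm fun j =>
    polyV (polyComp (p - (C.gr j).1) (q - (C.gr j).2) (killU (x j)))

lemma chainHomog_chainComp (C : PreCx) (p q : ℤ) (x : Msub C) :
    ChainHomog C (chainComp C p q x) p q :=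
  fun _ => isHomog_polyV_polyComp _ _ _

@[simp] lemma killU_chainComp (C : PreCx) (p q : ℤ) (x : Msub C) (j : Fin C.n) :
    killU (chainComp C p q x j) =
      polyComp (p - (C.gr j).1) (q - (C.gr j).2) (killU (x j)) := by
  simp [chainComp]

lemma mem_uSub_iff (C : PreCx) (x : Msub C) : x ∈ uSub C ↔ ∀ j, killU (x j) = 0 := by
  constructor
  · rintro ⟨y, rfl⟩ j
    simp
  · intro h
    choose s hs using fun j => (killU_eq_zero_iff _).1 (h j)
    refine ⟨Finsupp.equivFunOnFinite.symm s, ?_⟩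
    ext j
    simp [hs j]

lemma dmap_coord (C : PreCx) (x : Msub C) (j : Fin C.n) :
    dmap C x j = ∑ i, x i * C.dm i j := by
  rw [dmap, Finsupp.linearCombination_apply, Finsupp.sum_fintype _ _ (by simp)]
  simp [Finsupp.finsetSum_apply, Finsupp.single_apply]

lemma dmap_single (C : PreCx) (i : Fin C.n) :
    dmap C (Finsupp.single i 1) = ∑ j, Finsupp.single j (C.dm i j) := by
  simp [dmap]

lemma IsKnotLike.polyComp_killU_dmap {C : PreCx} (hC : IsKnotLike C) (p q : ℤ) (y : Msub C)
    (j : Fin C.n) :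
    polyComp (p - (C.gr j).1) (q - (C.gr j).2) (killU (dmap C y j)) =
      killU (dmap C (chainComp C (p + 1) (q + 1) y) j) := by
  simp only [dmap_coord, map_sum, map_mul, polyComp_sum, killU_chainComp]
  refine Finset.sum_congr rfl fun i _ => ?_
  rcases (hC.dhomog i j).killU_eq with h | ⟨e, h, hp, hq⟩
  · simp [h]
  · rw [h, polyComp_mul_X_pow]
    congr 2 <;> omega

lemma IsKnotLike.exists_chainHomog_primitive {C : PreCx} (hC : IsKnotLike C) {z : Msub C}
    (hz : z ∈ bdryU C) (p q : ℤ) :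
    ∃ y, ChainHomog C y (p + 1) (q + 1) ∧
      ∀ j, killU (dmap C y j) = polyComp (p - (C.gr j).1) (q - (C.gr j).2) (killU (z j)) := by
  obtain ⟨u, hu, w, ⟨y, rfl⟩, rfl⟩ := Submodule.mem_sup.1 hz
  refine ⟨chainComp C (p + 1) (q + 1) y, chainHomog_chainComp _ _ _ _, fun j => ?_⟩
  rw [← hC.polyComp_killU_dmap, Finsupp.add_apply, map_add, (mem_uSub_iff C u).1 hu j, zero_add]

lemma ChainHomog.polyComp_killU_Vv_pow {C : PreCx} {x : Msub C} {p q : ℤ}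
    (hx : ChainHomog C x p q) (k : ℕ) (j : Fin C.n) :
    polyComp (p - (C.gr j).1) (q - 2 * k - (C.gr j).2) (killU ((Vv ^ k • x) j)) =
      killU ((Vv ^ k • x) j) := by
  rw [Finsupp.smul_apply, smul_eq_mul]
  rcases (hx j).Vv_pow_mul k with h | ⟨e, h, hp, hq⟩
  · simp [h]
  · rw [h, ← one_mul (Polynomial.X ^ e : Polynomial (ZMod 2)), polyComp_mul_X_pow,
      show q - 2 * k - (C.gr j).2 + 2 * (e : ℤ) = 0 by omega, hp]
    simp [polyComp]

lemma IsKnotLike.exists_chainHomog_primitive_of_Vv_pow {C : PreCx} (hC : IsKnotLike C)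
    {x : Msub C} {p q : ℤ} (hx : ChainHomog C x p q) {k : ℕ} (hk : Vv ^ k • x ∈ bdryU C) :
    ∃ y, ChainHomog C y (p + 1) (q - 2 * k + 1) ∧ dmap C y - Vv ^ k • x ∈ uSub C := by
  obtain ⟨y, hy, h⟩ := hC.exists_chainHomog_primitive hk p (q - 2 * k)
  refine ⟨y, hy, (mem_uSub_iff _ _).2 fun j => ?_⟩
  rw [Finsupp.sub_apply, map_sub, h, hx.polyComp_killU_Vv_pow, sub_self]

/-- `V`-tower generators are maximally `V`-graded among the `V`-nontorsion cycles of `C/U`. -/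
lemma IsVTowerGen.le_gr {C : PreCx} (hC : IsKnotLike C) {w a : Msub C} {p q p' q' : ℤ}
    (hw : IsVTowerGen C w) (hwh : ChainHomog C w p q) (hac : dmap C a ∈ uSub C)
    (hat : ∀ k : ℕ, Vv ^ k • a ∉ bdryU C) (hah : ChainHomog C a p' q') : q' ≤ q := by
  by_contra! hlt
  obtain ⟨r, k, hk⟩ := hw.2.2 a hac
  obtain ⟨y, -, hy⟩ := hC.exists_chainHomog_primitive hk p' (q' - 2 * k)
  refine hat k (Submodule.mem_sup.2 ⟨Vv ^ k • a - dmap C y, ?_, dmap C y, ⟨y, rfl⟩, by abel⟩)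
  refine (mem_uSub_iff _ _).2 fun j => ?_
  have hsplit : killU ((Vv ^ k • a) j) =
      killU ((Vv ^ k • (a - r • w)) j) + killU r * killU (Vv ^ k * w j) := by
    simp only [Finsupp.smul_apply, Finsupp.sub_apply, smul_eq_mul, map_mul, map_sub]
    ring
  have hzero : polyComp (p' - (C.gr j).1) (q' - 2 * k - (C.gr j).2)
      (killU r * killU (Vv ^ k * w j)) = 0 := by
    rcases (hwh j).Vv_pow_mul k with h | ⟨e, h, -, hq⟩
    · simp [h]
    · rw [h, polyComp_mul_X_pow, polyComp_eq_zero_of_pos (by omega), zero_mul]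
  rw [Finsupp.sub_apply, map_sub, hy, ← hah.polyComp_killU_Vv_pow k j, hsplit, polyComp_add,
    hzero, add_zero, sub_self]

/-! ### Short maps in terms of the images of the preferred basis -/

/-- The image of `∂x_i` under the map sending the preferred basis vector `x_k` of the standard
complex of parameters `M` to `v k`. -/
noncomputable def stdBdry {C : PreCx} (M : List ℤ) (v : ℕ → Msub C) (i : ℕ) : Msub C :=
  (if M.getD i 0 < 0 then
    (if i % 2 = 0 then Uv else Vv) ^ (M.getD i 0).natAbs • v (i + 1) else 0) +
  (if 1 ≤ i ∧ 0 < M.getD (i - 1) 0 then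
    (if (i - 1) % 2 = 0 then Uv else Vv) ^ (M.getD (i - 1) 0).natAbs • v (i - 1) else 0)

lemma map_dmap_stdCx {C : PreCx} (M : List ℤ) (f : Msub (StdCx M) →ₗ[RUV] Msub C)
    (v : ℕ → Msub C) (hv : ∀ k : Fin (M.length + 1), f (Finsupp.single k 1) = v k)
    (i : Fin (M.length + 1)) :
    f (dmap (StdCx M) (Finsupp.single i 1)) = stdBdry M v i := by
  have hd : dmap (StdCx M) (Finsupp.single i 1) =
      ∑ j : Fin (M.length + 1), stdDm M i j • (Finsupp.single j 1 : Msub (StdCx M)) := by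
    refine (dmap_single (StdCx M) i).trans (Finset.sum_congr rfl fun j _ => ?_)
    exact (Finsupp.smul_single_one j _).symm
  rw [hd, map_sum]
  have hterm : ∀ j : Fin (M.length + 1),
      f (stdDm M i j • (Finsupp.single j 1 : Msub (StdCx M))) =
      (if (j : ℕ) = i + 1 then (if M.getD i 0 < 0 then
        (if (i : ℕ) % 2 = 0 then Uv else Vv) ^ (M.getD i 0).natAbs • v (i + 1) else 0) else 0) +
      (if (j : ℕ) + 1 = i then (if 1 ≤ (i : ℕ) ∧ 0 < M.getD (i - 1) 0 then
        (if ((i : ℕ) - 1) % 2 = 0 then Uv else Vv) ^ (M.getD (i - 1) 0).natAbs • v (i - 1)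
          else 0) else 0) := by
    intro j
    rw [map_smul, hv, stdDm]
    by_cases h1 : (j : ℕ) = i + 1
    · have h2 : ¬ (i : ℕ) = j + 1 := by omega
      have h3 : ¬ (j : ℕ) + 1 = i := by omega
      simp only [h1, true_and, if_true]
      split_ifs <;> first | omega | simp
    · by_cases h2 : (i : ℕ) = j + 1
      · have h3 : ¬ (j : ℕ) = j + 1 + 1 := by omega
        simp [h2, h3]
      · have h3 : ¬ (j : ℕ) + 1 = i := by omega
        simp [h1, h2, h3]
  simp only [hterm, Finset.sum_add_distrib]
  rw [stdBdry]
  congr 1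
  · by_cases h : (i : ℕ) + 1 < M.length + 1
    · rw [Finset.sum_eq_single ⟨i + 1, h⟩]
      · simp
      · intro j _ hj
        exact if_neg fun h' => hj (Fin.ext h')
      · simp
    · have : M.getD i 0 = 0 := List.getD_eq_default _ _ (by omega)
      simp only [this, lt_irrefl, if_false, ite_self, Finset.sum_const_zero]
  · by_cases h : 1 ≤ (i : ℕ)
    · rw [Finset.sum_eq_single ⟨i - 1, by omega⟩]
      · exact if_pos (by simp only; omega)
      · intro j _ hj
        exact if_neg fun h' => hj (Fin.ext (by simp only; omega))
      · simp
    · simp [h]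

lemma isShortLocalMap_iff {C : PreCx} (M : List ℤ) (f : Msub (StdCx M) →ₗ[RUV] Msub C)
    (v : ℕ → Msub C) (hv : ∀ k : Fin (M.length + 1), f (Finsupp.single k 1) = v k) :
    IsShortLocalMap M C f ↔
      ((∃ s : ℤ, ∀ i ≤ M.length, ChainHomog C (v i) (grRel M i).1
        ((grRel M i).2 - (grRel M M.length).2 + s)) ∧
      (∀ i, 1 ≤ i → i + 1 ≤ M.length → stdBdry M v i = dmap C (v i)) ∧
      dmap C (v M.length) - stdBdry M v M.length ∈ uSub C) ∧ IsVTowerGen C (v 0) := by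
  have hb := map_dmap_stdCx M f v hv
  unfold IsShortLocalMap IsShortMap
  refine and_congr (and_congr (exists_congr fun s => ?_) (and_congr ?_ ?_)) ?_
  · constructor
    · intro h i hi j
      have := h (⟨i, Nat.lt_succ_of_le hi⟩ : Fin (M.length + 1)) j
      rw [hv] at this
      simpa [StdCx, stdGr] using this
    · intro h i j
      have := h i (Nat.lt_succ_iff.1 i.2) j
      rw [← hv i] at this
      simpa [StdCx, stdGr] using this
  · constructor
    · intro h i h1 h2
      have := h ⟨i, by omega⟩ h1 h2
      rwa [hb, hv] at this
    · intro h i h1 h2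
      rw [hb, hv]
      exact h i h1 h2
  · rw [hb, hv]
    rfl
  · rw [hv]
    rfl

lemma grRel_append_of_le (L M : List ℤ) {i : ℕ} (hi : i ≤ L.length) :
    grRel (L ++ M) i = grRel L i := by
  refine Finset.sum_congr rfl fun k hk => ?_
  rw [List.getD_append _ _ _ _ (by have := Finset.mem_range.1 hk; omega)]

lemma grRel_append_singleton (L : List ℤ) (b : ℤ) :
    grRel (L ++ [b]) (L.length + 1) = grRel L L.length + stepShift L.length b := by
  rw [grRel, Finset.sum_range_succ, ← grRel, grRel_append_of_le _ _ le_rfl]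
  simp

lemma grRel_fst_emod_two (L : List ℤ) (i : ℕ) : (grRel L i).1 % 2 = (i : ℤ) % 2 := by
  induction i with
  | zero => simp [grRel]
  | succ i ih =>
    rw [grRel, Finset.sum_range_succ, ← grRel, Prod.fst_add]
    have : (stepShift i (L.getD i 0)).1 % 2 = 1 := by
      unfold stepShift
      split_ifs <;> simp only <;> omega
    push_cast
    omega

lemma stdBdry_mem_uSub {C : PreCx} (M : List ℤ) (v : ℕ → Msub C) {i : ℕ} (hi : Odd i)
    (hv : v (i + 1) = 0) : stdBdry M v i ∈ uSub C := by
  obtain ⟨d, rfl⟩ := hi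
  rw [stdBdry, hv, smul_zero, ite_self, zero_add]
  split_ifs with h1 h2
  · obtain ⟨e, he⟩ := Nat.exists_eq_succ_of_ne_zero
      (show (M.getD (2 * d + 1 - 1) 0).natAbs ≠ 0 by omega)
    rw [he, pow_succ', mul_smul]
    exact ⟨_, rfl⟩
  · omega
  · exact zero_mem _

/-- Truncating a final arrow whose target is sent to zero: the last generator may instead be
sent to a primitive of a `V`-power multiple of the image of the previous generator. -/
lemma IsKnotLike.exists_isShortLocalMap_append_pos {C : PreCx} (hC : IsKnotLike C) (L : List ℤ)
    (hodd : Odd L.length) (t : ℤ) (f : Msub (StdCx (L ++ [-t])) →ₗ[RUV] Msub C)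
    (hf : IsShortLocalMap (L ++ [-t]) C f)
    (hlast : f (Finsupp.single (Fin.last (L ++ [-t]).length) 1) = 0) :
    ∃ b : ℤ, 0 < b ∧ ∃ g : Msub (StdCx (L ++ [b])) →ₗ[RUV] Msub C,
      IsShortLocalMap (L ++ [b]) C g := by
  obtain ⟨v, hv⟩ : ∃ v : ℕ → Msub C,
      ∀ k : Fin ((L ++ [-t]).length + 1), f (Finsupp.single k 1) = v k :=
    ⟨fun k => if h : k < (L ++ [-t]).length + 1 then f (Finsupp.single ⟨k, h⟩ 1) else 0,
      fun k => by
        simp only [k.2, dif_pos]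
        rfl⟩
  have hlen : ∀ c : ℤ, (L ++ [c]).length = L.length + 1 := by simp
  have hv0 : v (L.length + 1) = 0 := by
    have := hv (Fin.last _)
    rw [hlast, Fin.val_last, hlen] at this
    exact this.symm
  obtain ⟨⟨⟨s, hs⟩, hchain, -⟩, htower⟩ := (isShortLocalMap_iff _ f v hv).1 hf
  have hpos : 1 ≤ L.length := hodd.pos
  have hm := hchain L.length hpos (hlen _).ge
  have hcyc : dmap C (v L.length) ∈ uSub C := hm ▸ stdBdry_mem_uSub _ v hodd hv0
  have hsm := hs L.length (by simp)
  rw [grRel_append_of_le _ _ le_rfl] at hsm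
  obtain ⟨k, hk⟩ : ∃ k : ℕ, Vv ^ k • v L.length ∈ bdryU C := by
    by_contra! hcon
    have h0 := hC.vTowerGr _ _ _ hsm hcyc hcon
    have h1 := grRel_fst_emod_two L L.length
    obtain ⟨d, hd⟩ := hodd
    rw [h0, hd] at h1
    push_cast at h1
    omega
  have hk' : Vv ^ (k + 1) • v L.length ∈ bdryU C := by
    rw [pow_succ', mul_smul]
    exact Submodule.smul_mem _ _ hk
  obtain ⟨y, hyh, hy⟩ := hC.exists_chainHomog_primitive_of_Vv_pow hsm hk'
  set b : ℤ := k + 1 with hb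
  set v' : ℕ → Msub C := Function.update v (L.length + 1) y with hv'
  have hv'le : ∀ i ≤ L.length, v' i = v i := fun i hi =>
    Function.update_of_ne (by omega) _ _
  have hv'last : v' (L.length + 1) = y := Function.update_self _ _ _
  have hoddmod : L.length % 2 = 1 := Nat.odd_iff.1 hodd
  obtain ⟨g, hg⟩ : ∃ g : (Fin ((L ++ [b]).length + 1) →₀ RUV) →ₗ[RUV] Msub C,
      ∀ i, g (Finsupp.single i 1) = v' i :=
    ⟨Finsupp.linearCombination RUV fun i => v' i, fun i => by simp⟩
  refine ⟨b, by omega, g, (isShortLocalMap_iff _ g v' hg).2 ?_⟩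
  refine ⟨⟨⟨s - (grRel (L ++ [-t]) (L ++ [-t]).length).2 +
    (grRel (L ++ [b]) (L ++ [b]).length).2, ?_⟩, ?_, ?_⟩, ?_⟩
  · intro i hi
    rw [hlen] at hi
    rcases Nat.lt_or_ge L.length i with h | h
    · obtain rfl : i = L.length + 1 := by omega
      rw [hv'last, hlen, hlen, grRel_append_singleton]
      convert hyh using 1
      · simp [stepShift, hoddmod, show ¬ b < 0 by omega]
      · have : (stepShift L.length b).2 = 1 - 2 * b := by
          simp [stepShift, hoddmod, show ¬ b < 0 by omega, abs_of_pos (show 0 < b by omega)]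
        rw [Prod.snd_add, this, hlen]
        push_cast
        omega
    · rw [hv'le i h, grRel_append_of_le _ _ h]
      have := hs i (by rw [hlen]; omega)
      rw [grRel_append_of_le _ _ h] at this
      convert this using 1
      ring
  · intro i h1 h2
    rw [hlen] at h2
    have hi : i ≤ L.length := by omega
    rw [hv'le i hi, ← hchain i h1 (by rw [hlen]; omega), stdBdry, stdBdry,
      hv'le (i - 1) (by omega), List.getD_append _ _ _ (i - 1) (by omega),
      List.getD_append _ _ _ (i - 1) (by omega)]
    congr 1
    rcases hi.lt_or_eq with h | rfl
    · rw [hv'le (i + 1) h, List.getD_append _ _ _ i h, List.getD_append _ _ _ i h]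
    · rw [hv0, smul_zero, ite_self]
      exact if_neg (by simp; omega)
  · have hlastB : stdBdry (L ++ [b]) v' (L.length + 1) = Vv ^ (k + 1) • v L.length := by
      have h1 : (L ++ [b]).getD (L.length + 1) 0 = 0 := List.getD_eq_default _ _ (by simp)
      have h2 : (L ++ [b]).getD (L.length + 1 - 1) 0 = b := by simp
      rw [stdBdry, h1, h2, if_neg (lt_irrefl _), zero_add, if_pos (by omega),
        Nat.add_sub_cancel, if_neg (by omega), hv'le _ le_rfl,
        show b.natAbs = k + 1 by omega]
    rw [hlen, hlastB, hv'last]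
    exact hy
  · rwa [hv'le 0 (by omega)]

/-- Let `(t_i)_{i ∈ ℕ}` be a sequence of positive integers with
`t_i → ∞`, and let `f_i : C(b_1, …, b_{n-1}, -t_i) ⇝ C` be short local maps from
standard complexes to a fixed (reduced) knot-like complex `C`.  Then there exists some
`b_n > 0` and a short local map `f : C(b_1, …, b_{n-1}, b_n) ⇝ C`. -/
theorem short_local_maps_with_long_final_arrows
    (L : List ℤ) (hnz : ∀ b ∈ L, b ≠ 0) (hodd : Odd L.length)
    (C : PreCx) (hC : IsKnotLike C) (hred : Reduced C)
    (t : ℕ → ℤ) (ht0 : ∀ i, 0 < t i)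
    (htend : Filter.Tendsto t Filter.atTop Filter.atTop)
    (f : ∀ i : ℕ, Msub (StdCx (L ++ [-(t i)])) →ₗ[RUV] Msub C)
    (hf : ∀ i : ℕ, IsShortLocalMap (L ++ [-(t i)]) C (f i)) :
    ∃ b : ℤ, 0 < b ∧
      ∃ g : Msub (StdCx (L ++ [b])) →ₗ[RUV] Msub C,
        IsShortLocalMap (L ++ [b]) C g := by
  have hex : ∀ i, ∃ s : ℤ,
      ChainHomog C (f i (Finsupp.single (0 : Fin ((L ++ [-(t i)]).length + 1)) 1)) 0
        (s - (grRel L L.length).2 - 2 * t i + 1) ∧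
      ∃ p, ChainHomog C (f i (Finsupp.single (Fin.last (L ++ [-(t i)]).length) 1)) p s := by
    intro i
    obtain ⟨⟨⟨s, hs⟩, -⟩, -⟩ := hf i
    have hstep : (stepShift L.length (-(t i))).2 = 2 * t i - 1 := by
      have := ht0 i
      simp [stepShift, Nat.odd_iff.1 hodd, this, abs_of_pos this]
    have hlen : (L ++ [-(t i)]).length = L.length + 1 := by simp
    have htot : (grRel (L ++ [-(t i)]) (L ++ [-(t i)]).length).2 =
        (grRel L L.length).2 + (2 * t i - 1) := by
      rw [hlen, grRel_append_singleton, Prod.snd_add, hstep]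
    refine ⟨s, fun j => ?_, (grRel (L ++ [-(t i)]) (L ++ [-(t i)]).length).1, fun j => ?_⟩
    · convert hs (0 : Fin ((L ++ [-(t i)]).length + 1)) j using 1
      · simp [StdCx, stdGr, grRel]
      · simp only [StdCx, stdGr, htot]
        simp [grRel]
        ring
    · have hgr : ((StdCx (L ++ [-(t i)])).gr (Fin.last (L ++ [-(t i)]).length)).2 = 0 :=
        sub_self _
      convert hs (Fin.last (L ++ [-(t i)]).length) j using 1
      · rw [add_zero]
        rfl
      · rw [hgr, zero_add]
  choose s hs0 p hsl using hex
  obtain ⟨B, hB⟩ : ∃ B : ℤ, ∀ j, (C.gr j).2 ≤ B := by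
    obtain ⟨B, hB⟩ := (Set.finite_range fun j => (C.gr j).2).bddAbove
    exact ⟨B, fun j => hB ⟨j, rfl⟩⟩
  obtain ⟨i, hi⟩ := (htend.eventually_gt_atTop (max (t 0) (B - s 0 + 2 * t 0))).exists
  have h0 := (hf 0).2
  have hle := (hf i).2.le_gr hC (hs0 i) h0.1 h0.2.1 (hs0 0)
  refine hC.exists_isShortLocalMap_append_pos L hodd (t i) (f i) (hf i) (Finsupp.ext fun j => ?_)
  refine (hsl i j).eq_zero_of_pos ?_
  have := hB j
  have := ht0 i
  have := lt_of_le_of_lt (le_max_left _ _) hi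
  have := lt_of_le_of_lt (le_max_right _ _) hi
  omega
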